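/- arXiv:1110.3350 — 9 statements merged into one kernel-verified Lean document; each statement's English description precedes it below -/
import Mathlib

section
/- Let V₁, …, Vₙ be vector spaces over a field F, and for each i let (f_{i,b})_{b ∈ Bᵢ} be a linearly independent family of linear functionals on Vᵢ. Then the family of F-valued functions on V₁ × ⋯ × Vₙ given by (v₁, …, vₙ) ↦ f_{1,b₁}(v₁) · f_{2,b₂}(v₂) ⋯ f_{n,bₙ}(vₙ), indexed by (b₁, …, bₙ) ∈ B₁ × ⋯ × Bₙ, is linearly independent in the vector space of all F-valued functions on V₁ × ⋯ × Vₙ (with pointwise operations). -/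
/-- A member of a linearly independent family of functionals is nonzero at some common zero
of any given finitely many other members. -/
theorem LinearIndependent.exists_apply_ne_zero_of_finset {F V κ : Type*} [Field F]
    [AddCommGroup V] [Module F V] {f : κ → (V →ₗ[F] F)} (hf : LinearIndependent F f)
    (t : Finset κ) (c : κ) :
    ∃ v : V, f c v ≠ 0 ∧ ∀ b ∈ t, b ≠ c → f b v = 0 := by
  classical
  by_contra! h
  have hker : ⨅ b : t.erase c, LinearMap.ker (f b) ≤ LinearMap.ker (f c) := by
    intro v hv
    simp only [Submodule.mem_iInf, LinearMap.mem_ker] at hv ⊢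
    by_contra hne
    obtain ⟨b, hbt, hbc, hb⟩ := h v hne
    exact hb (hv ⟨b, Finset.mem_erase.2 ⟨hbc, hbt⟩⟩)
  have hmem := mem_span_of_iInf_ker_le_ker hker
  have hrange : Set.range (fun b : t.erase c => f b) = f '' (t.erase c : Finset κ) := by
    ext g
    simp [and_comm]
  rw [hrange] at hmem
  exact hf.notMem_span_image (by simp) hmem

/-- If for each `i` the family `f i` of linear functionals on `V i` is linearly independent,
then the family of pointwise products `(v₁, …, vₙ) ↦ ∏ i, f i (b i) (v i)`, indexed by tuples
`b` of indices, is linearly independent in the space of `F`-valued functions on `V₁ × ⋯ × Vₙ`. -/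
theorem functional_product_linearIndependent {F : Type*} [Field F] {n : ℕ}
    {V : Fin n → Type*} [∀ i, AddCommGroup (V i)] [∀ i, Module F (V i)]
    {κ : Fin n → Type*} (f : ∀ i, κ i → (V i →ₗ[F] F))
    (hf : ∀ i, LinearIndependent F (f i)) :
    LinearIndependent F
      (fun b : ∀ i, κ i => (fun v : ∀ i, V i => ∏ i, f i (b i) (v i))) := by
  classical
  rw [linearIndependent_iff']
  intro s g hg c hc
  choose v hvc hv using fun i =>
    (hf i).exists_apply_ne_zero_of_finset (s.image fun b => b i) (c i)
  have hsum := congrFun hg v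
  simp only [Finset.sum_apply, Pi.smul_apply, smul_eq_mul, Pi.zero_apply] at hsum
  rw [Finset.sum_eq_single_of_mem c hc] at hsum
  · exact (mul_eq_zero.1 hsum).resolve_right (Finset.prod_ne_zero_iff.2 fun i _ => hvc i)
  · intro b hb hbc
    obtain ⟨i, hi⟩ := Function.ne_iff.1 hbc
    rw [Finset.prod_eq_zero (Finset.mem_univ i)
      (hv i (b i) (Finset.mem_image_of_mem (fun b => b i) hb) hi), mul_zero]
end

section
/- Let V be a vector space over a field F and let (v₁, …, vₙ) and (w₁, …, wₙ) be two linearly independent n-tuples of vectors of V. Then span{v₁, …, vₙ} = span{w₁, …, wₙ} if and only if there exists a nonzero scalar c ∈ F with w₁∧⋯∧wₙ = c • (v₁∧⋯∧vₙ) in the exterior algebra of V. -/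
namespace ExteriorAlgebra

theorem ιMulti_ne_zero_iff {F V : Type*} [Field F] [AddCommGroup V] [Module F V] {n : ℕ}
    {v : Fin n → V} : ιMulti F n v ≠ 0 ↔ LinearIndependent F v := by
  refine ⟨fun h => ?_, fun hv h => ?_⟩
  · by_contra hv
    exact h ((ιMulti F n).map_linearDependent v hv)
  · obtain ⟨g, hg⟩ := (Fintype.linearCombination F v).exists_leftInverse_of_injective
      (LinearMap.ker_eq_bot.2 (hv.fintypeLinearCombination_injective))
    have hgv (i : Fin n) : g (v i) = Pi.single i 1 := by
      simpa using LinearMap.congr_fun hg (Pi.single i 1)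
    have h' : exteriorPower.ιMulti F n v = 0 := Subtype.ext h
    have key := exteriorPower.alternatingMapLinearEquiv_apply_ιMulti
      ((Pi.basisFun F (Fin n)).det.compLinearMap g) v
    have hcomp : (fun i => g (v i)) = Pi.basisFun F (Fin n) := by
      ext1 i
      simp [hgv]
    rw [h', map_zero, AlternatingMap.compLinearMap_apply, hcomp, Module.Basis.det_self] at key
    exact zero_ne_one key

theorem mem_span_range_iff_ι_mul_ιMulti_eq_zero {F V : Type*} [Field F] [AddCommGroup V]
    [Module F V] {n : ℕ} {v : Fin n → V} (hv : LinearIndependent F v) (x : V) :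
    x ∈ Submodule.span F (Set.range v) ↔ ι F x * ιMulti F n v = 0 := by
  have h := ιMulti_ne_zero_iff (F := F) (v := (Fin.cons x v : Fin (n + 1) → V))
  rw [linearIndependent_finCons, ιMulti_succ_apply] at h
  simp only [Fin.cons_zero, Matrix.vecTail, Function.comp_def, Fin.cons_succ] at h
  tauto

theorem exists_ιMulti_eq_smul {F V : Type*} [Field F] [AddCommGroup V] [Module F V] {n : ℕ}
    {v w : Fin n → V} (hv : LinearIndependent F v)
    (hw : ∀ i, w i ∈ Submodule.span F (Set.range v)) :
    ∃ c : F, ιMulti F n w = c • ιMulti F n v := by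
  let e := Module.Basis.span hv
  have he (i : Fin n) : (e i : V) = v i := congrArg Subtype.val (Module.Basis.span_apply hv i)
  have key : (ιMulti F n).compLinearMap (Submodule.span F (Set.range v)).subtype =
      (LinearMap.toSpanSingleton F _ (ιMulti F n v)).compAlternatingMap e.det := by
    refine Module.Basis.ext_alternating e fun σ hσ => ?_
    obtain ⟨τ, rfl⟩ : ∃ τ : Equiv.Perm (Fin n), ⇑τ = σ :=
      ⟨Equiv.ofBijective σ (Finite.injective_iff_bijective.1 hσ), rfl⟩
    have hdet : e.det (fun i => e (τ i)) = (Equiv.Perm.sign τ : ℤ) := by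
      simpa [Function.comp_def, Units.smul_def, e.det_self] using e.det.map_perm e τ
    have hmul : ιMulti F n (fun i => v (τ i)) = (Equiv.Perm.sign τ : ℤ) • ιMulti F n v :=
      (ιMulti F n).map_perm v τ
    simp only [AlternatingMap.compLinearMap_apply, LinearMap.compAlternatingMap_apply,
      Submodule.subtype_apply, he, hdet, hmul, LinearMap.toSpanSingleton_apply,
      Int.cast_smul_eq_zsmul]
  let w' : Fin n → Submodule.span F (Set.range v) := fun i => ⟨w i, hw i⟩
  exact ⟨e.det w', DFunLike.congr_fun key w'⟩

end ExteriorAlgebra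


/-- Two linearly independent `n`-tuples of vectors span the same subspace if and only if their
wedges (blades) in the exterior algebra are proportional by a nonzero scalar. -/
theorem span_eq_iff_exterior_prod_proportional {F V : Type*} [Field F] [AddCommGroup V]
    [Module F V] {n : ℕ} (v w : Fin n → V)
    (hv : LinearIndependent F v) (hw : LinearIndependent F w) :
    Submodule.span F (Set.range v) = Submodule.span F (Set.range w) ↔
      ∃ c : F, c ≠ 0 ∧
        (List.ofFn fun i => ExteriorAlgebra.ι F (w i)).prod =
          c • (List.ofFn fun i => ExteriorAlgebra.ι F (v i)).prod := by
  simp only [← ExteriorAlgebra.ιMulti_apply]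
  constructor
  · intro h
    obtain ⟨c, hc⟩ := ExteriorAlgebra.exists_ιMulti_eq_smul (w := w) hv fun i =>
      h ▸ Submodule.subset_span ⟨i, rfl⟩
    refine ⟨c, ?_, hc⟩
    rintro rfl
    exact ExteriorAlgebra.ιMulti_ne_zero_iff.2 hw (by simpa using hc)
  · rintro ⟨c, hc, h⟩
    ext x
    rw [ExteriorAlgebra.mem_span_range_iff_ι_mul_ιMulti_eq_zero hv,
      ExteriorAlgebra.mem_span_range_iff_ι_mul_ιMulti_eq_zero hw, h, mul_smul_comm,
      smul_eq_zero_iff_right hc]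
end

section
/- Let V be a finite-dimensional vector space over a field F and let p be a natural number. Then there exists a linear equivalence Φ̂ from the p-th exterior power ⋀^p(V*) of the dual space V* onto the dual space (⋀^p V)* of the p-th exterior power of V, such that Φ̂(φ₁∧⋯∧φₚ)(v₁∧⋯∧vₚ) = det [φᵢ(vⱼ)]_{1≤i,j≤p} for all φ₁, …, φₚ ∈ V* and all v₁, …, vₚ ∈ V. -/
/-- The canonical wedge `v₁ ∧ ⋯ ∧ vₚ` as an element of the `p`-th exterior power `⋀[F]^p V`. -/
noncomputable def exteriorPowerWedge {F V : Type*} [Field F] [AddCommGroup V] [Module F V]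
    (p : ℕ) (v : Fin p → V) : ⋀[F]^p V :=
  ⟨ExteriorAlgebra.ιMulti F p v, ExteriorAlgebra.ιMulti_range F p ⟨v, rfl⟩⟩

/-- The pairing `⋀[R]^n (Dual R M) → Dual R (⋀[R]^n M)` sends the basis induced by the dual of a
finite basis `b` of `M` to the dual of the basis induced by `b`. -/
theorem exteriorPower.pairingDual_dualBasis_exteriorPower {R M I : Type*} [CommRing R]
    [AddCommGroup M] [Module R M] [LinearOrder I] [DecidableEq I] [Finite I] (n : ℕ)
    [DecidableEq (Set.powersetCard I n)] (b : Module.Basis I R M) (s : Set.powersetCard I n) :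
    exteriorPower.pairingDual R M n (b.dualBasis.exteriorPower n s) =
      (b.exteriorPower n).dualBasis s := by
  rw [exteriorPower.basis_apply, Module.Basis.coe_dualBasis, Module.Basis.coe_dualBasis,
    exteriorPower.basis_coord, exteriorPower.ιMultiDual]

/-- For a finite free module `M`, the pairing `⋀[R]^n (Dual R M) → Dual R (⋀[R]^n M)` is
bijective. -/
theorem exteriorPower.pairingDual_bijective (R M : Type*) [CommRing R] [AddCommGroup M]
    [Module R M] [Module.Free R M] [Module.Finite R M] (n : ℕ) :
    Function.Bijective (exteriorPower.pairingDual R M n) := by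
  classical
  let : LinearOrder (Module.Free.ChooseBasisIndex R M) := linearOrderOfSTO WellOrderingRel
  let b := Module.Free.chooseBasis R M
  let e := (b.dualBasis.exteriorPower n).equiv (b.exteriorPower n).dualBasis (Equiv.refl _)
  have he : exteriorPower.pairingDual R M n = e.toLinearMap :=
    (b.dualBasis.exteriorPower n).ext fun s => by
      rw [exteriorPower.pairingDual_dualBasis_exteriorPower, LinearEquiv.coe_coe,
        Module.Basis.equiv_apply, Equiv.refl_apply]
  rw [he]
  exact e.bijective

/-- For a finite-dimensional vector space `V`, the `p`-th exterior power of the dual space is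
linearly equivalent to the dual of the `p`-th exterior power of `V`, via a map `Φ̂` satisfying
`Φ̂ (φ₁ ∧ ⋯ ∧ φₚ) (v₁ ∧ ⋯ ∧ vₚ) = det [φᵢ (vⱼ)]`. -/
theorem exteriorPower_dual_equiv {F V : Type*} [Field F] [AddCommGroup V] [Module F V]
    [FiniteDimensional F V] (p : ℕ) :
    ∃ Φ : (⋀[F]^p (Module.Dual F V)) ≃ₗ[F] Module.Dual F (⋀[F]^p V),
      ∀ (φ : Fin p → Module.Dual F V) (v : Fin p → V),
        Φ (exteriorPowerWedge p φ) (exteriorPowerWedge p v) =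
          Matrix.det (Matrix.of fun i j => φ i (v j)) := by
  refine ⟨LinearEquiv.ofBijective _ (exteriorPower.pairingDual_bijective F V p), fun φ v => ?_⟩
  rw [← Matrix.det_transpose]
  exact exteriorPower.pairingDual_ιMulti_ιMulti φ v
end

section
/- Let F be a field, let d ≥ 1 and 0 ≤ n ≤ d, and let B be an invertible d×d matrix over F with inverse B⁻¹. Let C be the n×n submatrix of B consisting of its first n rows and first n columns, and let Γ be the (d−n)×(d−n) submatrix of B⁻¹ consisting of its last d−n rows and last d−n columns. Then det C = (det B) · (det Γ). -/
/-- Jacobi's identity for complementary diagonal blocks of a matrix and its right inverse. -/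
theorem Matrix.det_toBlocks₁₁_eq_det_mul_det_toBlocks₂₂ {m n R : Type*} [Fintype m] [Fintype n]
    [DecidableEq m] [DecidableEq n] [CommRing R] {M N : Matrix (m ⊕ n) (m ⊕ n) R}
    (h : M * N = 1) : M.toBlocks₁₁.det = M.det * N.toBlocks₂₂.det := by
  rw [← fromBlocks_toBlocks M, ← fromBlocks_toBlocks N, fromBlocks_multiply, ← fromBlocks_one,
    fromBlocks_inj] at h
  obtain ⟨-, h₁₂, -, h₂₂⟩ := h
  have key : M * fromBlocks 1 N.toBlocks₁₂ 0 N.toBlocks₂₂ =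
      fromBlocks M.toBlocks₁₁ 0 M.toBlocks₂₁ 1 := by
    conv_lhs => rw [← fromBlocks_toBlocks M]
    rw [fromBlocks_multiply, h₁₂, h₂₂]
    simp
  simpa using (congrArg det key).symm

/-- Jacobi's Determinant Identity: if `B` is an invertible `d × d` matrix, `C` is the upper-left
`n × n` submatrix of `B`, and `Γ` is the lower-right `(d-n) × (d-n)` submatrix of `B⁻¹`, then
`det C = det B * det Γ`. -/
theorem jacobi_determinant_identity {F : Type*} [Field F] {d n : ℕ} (hd : 1 ≤ d) (hn : n ≤ d)
    (B : Matrix (Fin d) (Fin d) F) (hB : IsUnit B.det) :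
    (B.submatrix (Fin.castLE hn) (Fin.castLE hn)).det =
      B.det *
        ((B⁻¹).submatrix
          (fun i : Fin (d - n) => (⟨n + i.1, by have := i.isLt; omega⟩ : Fin d))
          (fun j : Fin (d - n) => (⟨n + j.1, by have := j.isLt; omega⟩ : Fin d))).det := by
  let e : Fin n ⊕ Fin (d - n) ≃ Fin d :=
    finSumFinEquiv.trans (finCongr (Nat.add_sub_of_le hn))
  have h : B.submatrix e e * B⁻¹.submatrix e e = 1 := by
    rw [Matrix.submatrix_mul_equiv, Matrix.mul_nonsing_inv B hB, Matrix.submatrix_one_equiv]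
  rw [← Matrix.det_submatrix_equiv_self e B]
  exact Matrix.det_toBlocks₁₁_eq_det_mul_det_toBlocks₂₂ h
end

section
/- Let V be a vector space over a field F and let A, A′, B, B′, C, C′, P be seven pairwise distinct points of V. Suppose the lines AA′, BB′, CC′ are pairwise distinct and each contains P. Suppose further that C″ is a point lying on both AB and A′B′ with AB ≠ A′B′, that A″ is a point lying on both BC and B′C′ with BC ≠ B′C′, and that B″ is a point lying on both CA and C′A′ with CA ≠ C′A′. Then the points A″, B″, C″ are collinear. -/
/-- Distinct lines `AA'` and `BB'` meeting in `P` have independent directions `A - P`, `B - P`. -/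
theorem linearIndependent_sub_of_affineSpan_pair_ne
    {F V : Type*} [Field F] [AddCommGroup V] [Module F V] {A A' B B' P : V}
    (hPA : P ∈ affineSpan F ({A, A'} : Set V)) (hPB : P ∈ affineSpan F ({B, B'} : Set V))
    (hA : A ≠ P) (hB : B ≠ P)
    (hne : affineSpan F ({A, A'} : Set V) ≠ affineSpan F ({B, B'} : Set V)) :
    LinearIndependent F ![A - P, B - P] := by
  rw [LinearIndependent.pair_iff' (sub_ne_zero.2 hA)]
  intro k hk
  apply hne
  have hBmem : B ∈ affineSpan F ({P, A} : Set V) :=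
    mem_affineSpan_pair_iff_exists_lineMap_eq.2 ⟨k, by simp [AffineMap.lineMap_apply, hk]⟩
  rw [← affineSpan_pair_eq_of_mem_of_mem_of_ne hPA
      (left_mem_affineSpan_pair F A A') hA.symm,
    ← affineSpan_pair_eq_of_mem_of_mem_of_ne hPB
      (left_mem_affineSpan_pair F B B') hB.symm]
  exact (affineSpan_pair_eq_of_mem_of_mem_of_ne
    (left_mem_affineSpan_pair F P A) hBmem hB.symm).symm

/-- The intersection of `AB` and `A'B'`, when `P` divides `AA'` and `BB'` in the ratios given
by `p` and `q`, expressed with origin `P`. -/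
theorem smul_sub_eq_of_mem_affineSpan_pair
    {F V : Type*} [Field F] [AddCommGroup V] [Module F V] {A A' B B' P X : V} {p q : F}
    (hp : AffineMap.lineMap A A' p = P) (hq : AffineMap.lineMap B B' q = P)
    (hp0 : p ≠ 0) (hq0 : q ≠ 0) (hind : LinearIndependent F ![A - P, B - P])
    (hX : X ∈ affineSpan F ({A, B} : Set V)) (hX' : X ∈ affineSpan F ({A', B'} : Set V)) :
    (q - p) • (X - P) = (q - 1) • (B - P) - (p - 1) • (A - P) := by
  obtain ⟨s, rfl⟩ := mem_affineSpan_pair_iff_exists_lineMap_eq.1 hX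
  obtain ⟨t, ht⟩ := mem_affineSpan_pair_iff_exists_lineMap_eq.1 hX'
  have hA' : A' - P = (p⁻¹ * (p - 1)) • (A - P) := by
    rw [mul_smul, eq_inv_smul_iff₀ hp0, ← hp, AffineMap.lineMap_apply_module]
    module
  have hB' : B' - P = (q⁻¹ * (q - 1)) • (B - P) := by
    rw [mul_smul, eq_inv_smul_iff₀ hq0, ← hq, AffineMap.lineMap_apply_module]
    module
  have hcomb : ((1 - t) * (p⁻¹ * (p - 1)) - (1 - s)) • (A - P)
      + (t * (q⁻¹ * (q - 1)) - s) • (B - P) = 0 := by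
    rw [AffineMap.lineMap_apply_module, AffineMap.lineMap_apply_module] at ht
    linear_combination (norm := module) ht - (1 - t) • hA' - t • hB'
  obtain ⟨h₁, h₂⟩ := LinearIndependent.pair_iff.1 hind _ _ hcomb
  have h₁' : (1 - t) * (p - 1) = (1 - s) * p := by
    field_simp at h₁
    linear_combination h₁
  have h₂' : t * (q - 1) = s * q := by
    field_simp at h₂
    linear_combination h₂
  have hs : (q - p) * s = q - 1 := by
    linear_combination (q - 1) * h₁' + (p - 1) * h₂'
  rw [AffineMap.lineMap_apply_module]
  have : (q - p) • ((1 - s) • A + s • B - P)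
      = ((q - p) * s) • (B - P) - ((q - p) * s - (q - p)) • (A - P) := by module
  rw [this, hs]
  module

/-- In the situation of `smul_sub_eq_of_mem_affineSpan_pair` the ratios differ. -/
theorem ratio_ne_of_smul_sub_eq
    {F V : Type*} [Field F] [AddCommGroup V] [Module F V] {A B P X : V} {p q : F}
    (hp1 : p ≠ 1) (hAB : A ≠ B)
    (h : (q - p) • (X - P) = (q - 1) • (B - P) - (p - 1) • (A - P)) : q ≠ p := by
  rintro rfl
  have h' : (q - 1) • (B - A) = 0 := by
    rw [sub_self, zero_smul] at h
    rw [h]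
    module
  exact hAB.symm (sub_eq_zero.1 ((smul_eq_zero.1 h').resolve_left (sub_ne_zero.2 hp1)))

/-- A point of the line `AA'` other than `A` and `A'` is `lineMap A A' p` with `p ≠ 0, 1`. -/
theorem exists_lineMap_eq_of_mem_affineSpan_pair
    {F V : Type*} [Field F] [AddCommGroup V] [Module F V] {A A' P : V}
    (hP : P ∈ affineSpan F ({A, A'} : Set V)) (hA : A ≠ P) (hA' : A' ≠ P) :
    ∃ p : F, AffineMap.lineMap A A' p = P ∧ p ≠ 0 ∧ p ≠ 1 := by
  obtain ⟨p, hp⟩ := mem_affineSpan_pair_iff_exists_lineMap_eq.1 hP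
  refine ⟨p, hp, ?_, ?_⟩ <;> rintro rfl <;> simp_all

/-- Theorem of Desargues (completely nonparallel affine version): if `A, A', B, B', C, C', P`
are distinct points, the distinct lines `AA'`, `BB'`, `CC'` are concurrent in `P`, and the
pairs of nonparallel lines `AB, A'B'`, `BC, B'C'`, `CA, C'A'` meet respectively in `C''`,
`A''`, `B''`, then `A''`, `B''`, `C''` are collinear. -/
theorem desargues {F V : Type*} [Field F] [AddCommGroup V] [Module F V]
    (A A' B B' C C' P : V)
    (hdist : List.Pairwise (· ≠ ·) [A, A', B, B', C, C', P])
    (hlAB : affineSpan F ({A, A'} : Set V) ≠ affineSpan F ({B, B'} : Set V))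
    (hlAC : affineSpan F ({A, A'} : Set V) ≠ affineSpan F ({C, C'} : Set V))
    (hlBC : affineSpan F ({B, B'} : Set V) ≠ affineSpan F ({C, C'} : Set V))
    (hPA : P ∈ affineSpan F ({A, A'} : Set V))
    (hPB : P ∈ affineSpan F ({B, B'} : Set V))
    (hPC : P ∈ affineSpan F ({C, C'} : Set V))
    (A'' B'' C'' : V)
    (hC''1 : C'' ∈ affineSpan F ({A, B} : Set V))
    (hC''2 : C'' ∈ affineSpan F ({A', B'} : Set V))
    (hABne : affineSpan F ({A, B} : Set V) ≠ affineSpan F ({A', B'} : Set V))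
    (hA''1 : A'' ∈ affineSpan F ({B, C} : Set V))
    (hA''2 : A'' ∈ affineSpan F ({B', C'} : Set V))
    (hBCne : affineSpan F ({B, C} : Set V) ≠ affineSpan F ({B', C'} : Set V))
    (hB''1 : B'' ∈ affineSpan F ({C, A} : Set V))
    (hB''2 : B'' ∈ affineSpan F ({C', A'} : Set V))
    (hCAne : affineSpan F ({C, A} : Set V) ≠ affineSpan F ({C', A'} : Set V)) :
    Collinear F ({A'', B'', C''} : Set V) := by
  simp only [List.pairwise_cons, List.mem_cons, List.not_mem_nil, or_false, forall_eq_or_imp,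
    forall_eq] at hdist
  obtain ⟨⟨-, -, -, -, -, hAP⟩, ⟨-, -, -, -, hA'P⟩, ⟨-, hBC, -, hBP⟩, ⟨-, -, hB'P⟩,
    ⟨-, hCP⟩, hC'P, -⟩ := hdist
  obtain ⟨p, hp, hp0, hp1⟩ := exists_lineMap_eq_of_mem_affineSpan_pair hPA hAP hA'P
  obtain ⟨q, hq, hq0, hq1⟩ := exists_lineMap_eq_of_mem_affineSpan_pair hPB hBP hB'P
  obtain ⟨r, hr, hr0, hr1⟩ := exists_lineMap_eq_of_mem_affineSpan_pair hPC hCP hC'P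
  have hC := smul_sub_eq_of_mem_affineSpan_pair hp hq hp0 hq0
    (linearIndependent_sub_of_affineSpan_pair_ne hPA hPB hAP hBP hlAB) hC''1 hC''2
  have hA := smul_sub_eq_of_mem_affineSpan_pair hq hr hq0 hr0
    (linearIndependent_sub_of_affineSpan_pair_ne hPB hPC hBP hCP hlBC) hA''1 hA''2
  have hB := smul_sub_eq_of_mem_affineSpan_pair hr hp hr0 hp0
    (linearIndependent_sub_of_affineSpan_pair_ne hPC hPA hCP hAP hlAC.symm) hB''1 hB''2
  have hrq : r - q ≠ 0 := sub_ne_zero.2 (ratio_ne_of_smul_sub_eq hq1 hBC hA)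
  refine collinear_insert_of_mem_affineSpan_pair
    (mem_affineSpan_pair_iff_exists_lineMap_eq.2 ⟨(r - q)⁻¹ * (p - q), ?_⟩)
  rw [AffineMap.lineMap_apply_module', mul_smul, ← eq_sub_iff_add_eq, inv_smul_eq_iff₀ hrq]
  linear_combination (norm := module) -hA - hB - hC
end

section
/- Let V be a vector space over a field F, and let l and l′ be two distinct lines of V (cosets of 1-dimensional subspaces) whose union l ∪ l′ is coplanar. Let A, B, C be three distinct points of l \ l′ and let A′, B′, C′ be three distinct points of l′ \ l. Suppose A″ is a point lying on both lines BC′ and B′C, B″ is a point lying on both lines AC′ and A′C, and C″ is a point lying on both lines AB′ and A′B. Then the points A″, B″, C″ are collinear. -/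
open Pointwise

/-- The algebraic core of Pappus' theorem, in coordinates where the six points are
`A = (0, 0)`, `B = (b, 0)`, `C = (c, 0)`, `A' = (0, 1)`, `B' = (m * p, 1 + m * q)` and
`C' = (n * p, 1 + n * q)`. -/
lemma pappus_det_eq_zero {F : Type*} [Field F] {b c m n p q x₁ y₁ x₂ y₂ x₃ y₃ : F}
    (hb : b ≠ 0) (hc : c ≠ 0) (hbc : b ≠ c) (hm : 1 + m * q ≠ 0) (hn : 1 + n * q ≠ 0)
    (h₁ : y₁ * (n * p - b) = (x₁ - b) * (1 + n * q))
    (h₁' : y₁ * (m * p - c) = (x₁ - c) * (1 + m * q))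
    (h₂ : y₂ * (n * p) = x₂ * (1 + n * q)) (h₂' : x₂ = c * (1 - y₂))
    (h₃ : y₃ * (m * p) = x₃ * (1 + m * q)) (h₃' : x₃ = b * (1 - y₃)) :
    (x₂ - x₁) * (y₃ - y₁) = (y₂ - y₁) * (x₃ - x₁) := by
  have e₁ : y₁ * ((n * p - b) * (1 + m * q) - (m * p - c) * (1 + n * q)) =
      (c - b) * (1 + m * q) * (1 + n * q) := by
    linear_combination (1 + m * q) * h₁ - (1 + n * q) * h₁'
  have e₂ : y₂ * (n * p + c * (1 + n * q)) = c * (1 + n * q) := by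
    rw [h₂'] at h₂; linear_combination h₂
  have e₃ : y₃ * (m * p + b * (1 + m * q)) = b * (1 + m * q) := by
    rw [h₃'] at h₃; linear_combination h₃
  have d₁ := right_ne_zero_of_mul (e₁ ▸ mul_ne_zero (mul_ne_zero (sub_ne_zero.2 hbc.symm) hm) hn)
  have d₂ := right_ne_zero_of_mul (e₂ ▸ mul_ne_zero hc hn)
  have d₃ := right_ne_zero_of_mul (e₃ ▸ mul_ne_zero hb hm)
  have f₁ : x₁ * ((n * p - b) * (1 + m * q) - (m * p - c) * (1 + n * q)) =
      c * (n * p - b) * (1 + m * q) - b * (m * p - c) * (1 + n * q) := by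
    linear_combination (m * p - c) * h₁ - (n * p - b) * h₁'
  rw [h₂', h₃', eq_div_of_mul_eq d₁ f₁, eq_div_of_mul_eq d₁ e₁, eq_div_of_mul_eq d₂ e₂,
    eq_div_of_mul_eq d₃ e₃]
  clear e₁ e₂ e₃ f₁
  generalize hD₁ : (n * p - b) * (1 + m * q) - (m * p - c) * (1 + n * q) = D₁ at *
  generalize hD₂ : n * p + c * (1 + n * q) = D₂ at *
  generalize hD₃ : m * p + b * (1 + m * q) = D₃ at *
  field_simp
  rw [← hD₁, ← hD₂, ← hD₃]
  ring

/-- Points of an affine plane are collinear if the determinant of their coordinate differences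
vanishes. -/
lemma collinear_of_det_eq_zero {F V : Type*} [Field F] [AddCommGroup V] [Module F V]
    (O u d : V) {x₁ y₁ x₂ y₂ x₃ y₃ : F}
    (h : (x₂ - x₁) * (y₃ - y₁) = (y₂ - y₁) * (x₃ - x₁)) :
    Collinear F
      ({O + (x₁ • u + y₁ • d), O + (x₂ • u + y₂ • d), O + (x₃ • u + y₃ • d)} : Set V) := by
  rw [collinear_iff_of_mem (p₀ := O + (x₁ • u + y₁ • d)) (by simp)]
  simp only [Set.mem_insert_iff, Set.mem_singleton_iff, forall_eq_or_imp, forall_eq, vadd_eq_add]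
  by_cases hx : x₂ - x₁ = 0
  · by_cases hy : y₂ - y₁ = 0
    · refine ⟨(x₃ - x₁) • u + (y₃ - y₁) • d, ⟨0, by simp⟩, ⟨0, ?_⟩, ⟨1, by module⟩⟩
      rw [sub_eq_zero.1 hx, sub_eq_zero.1 hy]; simp
    · have hx₃ : x₃ = x₁ := by
        rw [hx, zero_mul, eq_comm, mul_eq_zero] at h
        exact sub_eq_zero.1 (h.resolve_left hy)
      refine ⟨d, ⟨0, by simp⟩, ⟨y₂ - y₁, ?_⟩, ⟨y₃ - y₁, ?_⟩⟩
      · rw [sub_eq_zero.1 hx]; module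
      · rw [hx₃]; module
  · refine ⟨(x₂ - x₁) • u + (y₂ - y₁) • d, ⟨0, by simp⟩, ⟨1, by module⟩,
      ⟨(x₃ - x₁) / (x₂ - x₁), ?_⟩⟩
    have h₁ : (x₃ - x₁) / (x₂ - x₁) * (x₂ - x₁) = x₃ - x₁ := div_mul_cancel₀ _ hx
    have h₂ : (x₃ - x₁) / (x₂ - x₁) * (y₂ - y₁) = y₃ - y₁ := by
      field_simp; linear_combination -h
    rw [smul_add, smul_smul, smul_smul, h₁, h₂]; module

/-- A coset of a one-dimensional subspace is parametrized from any of its points. -/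
lemma exists_forall_mem_line_iff {F V : Type*} [Field F] [AddCommGroup V] [Module F V]
    {l : Set V} (hl : ∃ (v : V) (W : Submodule F V), Module.finrank F W = 1 ∧ l = v +ᵥ (W : Set V))
    {A : V} (hA : A ∈ l) : ∃ u : V, ∀ X, X ∈ l ↔ ∃ t : F, X = A + t • u := by
  obtain ⟨v, W, hW, rfl⟩ := hl
  obtain ⟨u, -, hu⟩ := finrank_eq_one_iff'.1 hW
  obtain ⟨a, ha, rfl⟩ := hA
  refine ⟨u, fun X => ⟨?_, ?_⟩⟩
  · rintro ⟨x, hx, rfl⟩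
    obtain ⟨t, ht⟩ := hu ⟨x - a, W.sub_mem hx ha⟩
    have ht' : t • (u : V) = x - a := congrArg Subtype.val ht
    exact ⟨t, by simp [ht', add_assoc]⟩
  · rintro ⟨t, rfl⟩
    exact ⟨a + t • (u : V), W.add_mem ha (W.smul_mem t u.2), by simp [add_assoc]⟩

/-- Theorem of Pappus (affine version): let `l, l'` be distinct coplanar lines with distinct
points `A, B, C ⊆ l \ l'` and distinct points `A', B', C' ⊆ l' \ l`. If `BC'` meets `B'C` in
`A''`, `AC'` meets `A'C` in `B''`, and `AB'` meets `A'B` in `C''`, then `A''`, `B''`, `C''`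
are collinear. -/
theorem pappus {F V : Type*} [Field F] [AddCommGroup V] [Module F V]
    (l l' : Set V)
    (hl : ∃ (v : V) (W : Submodule F V), Module.finrank F W = 1 ∧ l = v +ᵥ (W : Set V))
    (hl' : ∃ (v : V) (W : Submodule F V), Module.finrank F W = 1 ∧ l' = v +ᵥ (W : Set V))
    (hne : l ≠ l') (hcop : Coplanar F (l ∪ l'))
    (A B C : V) (hA : A ∈ l \ l') (hB : B ∈ l \ l') (hC : C ∈ l \ l')
    (hAB : A ≠ B) (hAC : A ≠ C) (hBC : B ≠ C)
    (A' B' C' : V) (hA' : A' ∈ l' \ l) (hB' : B' ∈ l' \ l) (hC' : C' ∈ l' \ l)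
    (hAB' : A' ≠ B') (hAC' : A' ≠ C') (hBC' : B' ≠ C')
    (A'' B'' C'' : V)
    (hA''1 : A'' ∈ affineSpan F ({B, C'} : Set V))
    (hA''2 : A'' ∈ affineSpan F ({B', C} : Set V))
    (hB''1 : B'' ∈ affineSpan F ({A, C'} : Set V))
    (hB''2 : B'' ∈ affineSpan F ({A', C} : Set V))
    (hC''1 : C'' ∈ affineSpan F ({A, B'} : Set V))
    (hC''2 : C'' ∈ affineSpan F ({A', B} : Set V)) :
    Collinear F ({A'', B'', C''} : Set V) := by
  obtain ⟨u, hu⟩ := exists_forall_mem_line_iff hl hA.1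
  obtain ⟨w, hw⟩ := exists_forall_mem_line_iff hl' hA'.1
  obtain ⟨d, rfl⟩ : ∃ d, A' = A + d := ⟨A' - A, by abel⟩
  obtain ⟨b, rfl⟩ := (hu B).1 hB.1
  obtain ⟨c, rfl⟩ := (hu C).1 hC.1
  obtain ⟨m, rfl⟩ := (hw B').1 hB'.1
  obtain ⟨n, rfl⟩ := (hw C').1 hC'.1
  have hb : b ≠ 0 := by rintro rfl; simp at hAB
  have hc : c ≠ 0 := by rintro rfl; simp at hAC
  have hbc : b ≠ c := by rintro rfl; exact hBC rfl
  have hm0 : m ≠ 0 := by rintro rfl; simp at hAB'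
  have hd : ∀ t : F, d ≠ t • u := by
    rintro t rfl; exact hA'.2 ((hu _).2 ⟨t, rfl⟩)
  have hu0 : u ≠ 0 := by rintro rfl; simp at hAB
  -- `u` and `d` are linearly independent
  have hind : ∀ {x y x' y' : F}, x • u + y • d = x' • u + y' • d → x = x' ∧ y = y' := by
    intro x y x' y' h
    have hy : y = y' := by
      by_contra hy
      have hy' : y - y' ≠ 0 := sub_ne_zero.2 hy
      refine hd ((y - y')⁻¹ * (x' - x)) ?_
      rw [mul_smul, eq_inv_smul_iff₀ hy']
      linear_combination (norm := module) h
    subst hy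
    exact ⟨smul_left_injective F hu0 (add_right_cancel h), rfl⟩
  simp only [mem_affineSpan_pair_iff_exists_lineMap_eq, AffineMap.lineMap_apply, vsub_eq_sub,
    vadd_eq_add] at hA''1 hA''2 hB''1 hB''2 hC''1 hC''2
  obtain ⟨r₁, hr₁⟩ := hA''1
  obtain ⟨s₁, hs₁⟩ := hA''2
  obtain ⟨r₂, hr₂⟩ := hB''1
  obtain ⟨s₂, hs₂⟩ := hB''2
  obtain ⟨r₃, hr₃⟩ := hC''1
  obtain ⟨s₃, hs₃⟩ := hC''2
  obtain ⟨p, q, rfl⟩ : ∃ p q : F, w = p • u + q • d := by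
    -- this is forced by the lines through `A, B'` and `A', B` having a common point
    have h : (r₃ * m) • w = (s₃ * b) • u + (1 - s₃ - r₃) • d := by
      linear_combination (norm := module) hr₃ - hs₃
    have hr : r₃ ≠ 0 := by
      rintro rfl
      have h0 : (s₃ * b) • u + (1 - s₃ - 0) • d = (0 : F) • u + (0 : F) • d := by
        rw [← h]; simp
      obtain ⟨h1, h2⟩ := hind h0
      rw [(mul_eq_zero.1 h1).resolve_right hb] at h2
      simp at h2
    refine ⟨(r₃ * m)⁻¹ * (s₃ * b), (r₃ * m)⁻¹ * (1 - s₃ - r₃), ?_⟩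
    rw [mul_smul _ (s₃ * b), mul_smul _ (1 - s₃ - r₃), ← smul_add, ← h,
      inv_smul_smul₀ (mul_ne_zero hr hm0)]
  have hm : 1 + m * q ≠ 0 := fun h => hB'.2 ((hu _).2 ⟨m * p, by
    linear_combination (norm := module) congrArg (· • d) h⟩)
  have hn : 1 + n * q ≠ 0 := fun h => hC'.2 ((hu _).2 ⟨n * p, by
    linear_combination (norm := module) congrArg (· • d) h⟩)
  obtain ⟨i₁, j₁⟩ := hind (x := b + r₁ * (n * p - b)) (y := r₁ * (1 + n * q))
    (x' := m * p + s₁ * (c - m * p)) (y' := (1 - s₁) * (1 + m * q))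
    (by linear_combination (norm := module) hr₁ - hs₁)
  obtain ⟨i₂, j₂⟩ := hind (x := r₂ * (n * p)) (y := r₂ * (1 + n * q))
    (x' := s₂ * c) (y' := 1 - s₂) (by linear_combination (norm := module) hr₂ - hs₂)
  obtain ⟨i₃, j₃⟩ := hind (x := r₃ * (m * p)) (y := r₃ * (1 + m * q))
    (x' := s₃ * b) (y' := 1 - s₃) (by linear_combination (norm := module) hr₃ - hs₃)
  have key := collinear_of_det_eq_zero A u d (pappus_det_eq_zero (p := p) (q := q) hb hc hbc hm hn
    (x₁ := b + r₁ * (n * p - b)) (y₁ := r₁ * (1 + n * q)) (by ring)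
    (by rw [i₁, j₁]; ring)
    (x₂ := r₂ * (n * p)) (y₂ := r₂ * (1 + n * q)) (by ring) (by rw [i₂, j₂]; ring)
    (x₃ := r₃ * (m * p)) (y₃ := r₃ * (1 + m * q)) (by ring) (by rw [i₃, j₃]; ring))
  convert key using 2
  · rw [← hr₁]; module
  · congr 1
    · rw [← hr₂]; module
    · rw [← hr₃]; congr 1; module
end

section
/- Let V be a vector space over a field F and let A, B, C ∈ V be affinely independent points (equivalently, B − A and C − A are linearly independent). Let x, y, z ∈ F be scalars each different from 0 and from 1, and set A′ = B + x•(C − B), B′ = C + y•(A − C), and C′ = A + z•(B − A), so that A′ lies on line BC, B′ on line CA, and C′ on line AB, none of them a vertex. Then A′, B′, C′ are collinear if and only if x·y·z = −(1 − x)·(1 − y)·(1 − z). -/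
/-- Three points are collinear iff the difference vectors from the first one are linearly
dependent. -/
theorem collinear_triple_iff_not_linearIndependent {k V P : Type*} [DivisionRing k]
    [AddCommGroup V] [Module k V] [AddTorsor V P] (p q r : P) :
    Collinear k ({p, q, r} : Set P) ↔ ¬ LinearIndependent k ![q -ᵥ p, r -ᵥ p] := by
  rw [collinear_iff_not_affineIndependent_set,
    affineIndependent_iff_linearIndependent_vsub k _ (0 : Fin 3),
    ← linearIndependent_equiv (finSuccAboveEquiv (0 : Fin 3))]
  congr! 2
  ext i
  fin_cases i <;> rfl

/-- Theorem of Menelaus (vector form): with `A, B, C` affinely independent and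
`A' = B + x•(C−B)`, `B' = C + y•(A−C)`, `C' = A + z•(B−A)` for scalars `x, y, z` different
from `0` and `1`, the points `A'`, `B'`, `C'` are collinear if and only if
`x·y·z = −(1−x)(1−y)(1−z)` (the product of vector ratios equals `−1`). -/
theorem menelaus {F V : Type*} [Field F] [AddCommGroup V] [Module F V]
    (A B C : V) (hind : LinearIndependent F ![B - A, C - A])
    (x y z : F) (hx0 : x ≠ 0) (hx1 : x ≠ 1) (hy0 : y ≠ 0) (hy1 : y ≠ 1)
    (hz0 : z ≠ 0) (hz1 : z ≠ 1)
    (A' B' C' : V)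
    (hA' : A' = B + x • (C - B)) (hB' : B' = C + y • (A - C)) (hC' : C' = A + z • (B - A)) :
    Collinear F ({A', B', C'} : Set V) ↔
      x * y * z = -((1 - x) * (1 - y) * (1 - z)) := by
  have hB : B' - A' = (x - 1) • (B - A) + (1 - y - x) • (C - A) := by
    rw [hA', hB']
    module
  have hC : C' - A' = (z - 1 + x) • (B - A) + (-x) • (C - A) := by
    rw [hA', hC']
    module
  rw [collinear_triple_iff_not_linearIndependent, vsub_eq_sub, vsub_eq_sub, hB, hC,
    LinearIndependent.pair_add_smul_add_smul_iff, and_iff_right hind, not_ne_iff]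
  constructor <;> intro h <;> linear_combination h
end

section
/- Let V be a vector space over a field F and let A, B, C ∈ V be affinely independent points (equivalently, B − A and C − A are linearly independent). Let x, y, z ∈ F be scalars each different from 0 and from 1, and set A′ = B + x•(C − B), B′ = C + y•(A − C), and C′ = A + z•(B − A). Then the following holds: either there exists a point P lying on all three lines AA′, BB′, CC′ with P lying on none of the lines AB, BC, CA, or the three vectors A′ − A, B′ − B, C′ − C are pairwise linearly dependent (the three lines are parallel), if and only if x·y·z = (1 − x)·(1 − y)·(1 − z). -/
open AffineMap in
/-- Membership in a line, in affine coordinates with respect to a frame `O, u, v`. -/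
theorem LinearIndependent.add_smul_add_smul_mem_affineSpan_pair_iff {F V : Type*} [Field F]
    [AddCommGroup V] [Module F V] {u v : V} (h : LinearIndependent F ![u, v]) (O : V)
    (a b a₁ b₁ a₂ b₂ : F) :
    O + (a • u + b • v) ∈ affineSpan F
        ({O + (a₁ • u + b₁ • v), O + (a₂ • u + b₂ • v)} : Set V) ↔
      ∃ t : F, a₁ + t * (a₂ - a₁) = a ∧ b₁ + t * (b₂ - b₁) = b := by
  rw [mem_affineSpan_pair_iff_exists_lineMap_eq]
  refine exists_congr fun t => ?_
  have key : lineMap (O + (a₁ • u + b₁ • v)) (O + (a₂ • u + b₂ • v)) t =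
      O + ((a₁ + t * (a₂ - a₁)) • u + (b₁ + t * (b₂ - b₁)) • v) := by
    rw [lineMap_apply_module']
    module
  rw [key, add_right_inj]
  exact ⟨fun e => h.eq_of_pair e, fun ⟨e₁, e₂⟩ => by rw [e₁, e₂]⟩

/-- Theorem of Ceva (vector form): with `A, B, C` affinely independent and
`A' = B + x•(C−B)`, `B' = C + y•(A−C)`, `C' = A + z•(B−A)` for scalars `x, y, z` different
from `0` and `1`, the lines `AA'`, `BB'`, `CC'` are either concurrent in a point lying on none
of `AB`, `BC`, `CA`, or parallel (the vectors `A'−A`, `B'−B`, `C'−C` are pairwise linearly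
dependent), if and only if `x·y·z = (1−x)(1−y)(1−z)` (the product of vector ratios equals `1`). -/
theorem ceva {F V : Type*} [Field F] [AddCommGroup V] [Module F V]
    (A B C : V) (hind : LinearIndependent F ![B - A, C - A])
    (x y z : F) (hx0 : x ≠ 0) (hx1 : x ≠ 1) (hy0 : y ≠ 0) (hy1 : y ≠ 1)
    (hz0 : z ≠ 0) (hz1 : z ≠ 1)
    (A' B' C' : V)
    (hA' : A' = B + x • (C - B)) (hB' : B' = C + y • (A - C)) (hC' : C' = A + z • (B - A)) :
    ((∃ P : V,
        P ∈ affineSpan F ({A, A'} : Set V) ∧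
        P ∈ affineSpan F ({B, B'} : Set V) ∧
        P ∈ affineSpan F ({C, C'} : Set V) ∧
        P ∉ affineSpan F ({A, B} : Set V) ∧
        P ∉ affineSpan F ({B, C} : Set V) ∧
        P ∉ affineSpan F ({C, A} : Set V)) ∨
      (¬ LinearIndependent F ![A' - A, B' - B] ∧
        ¬ LinearIndependent F ![B' - B, C' - C] ∧
        ¬ LinearIndependent F ![A' - A, C' - C])) ↔
      x * y * z = (1 - x) * (1 - y) * (1 - z) := by
  have hcoord : ∃ u v : V, LinearIndependent F ![u, v] ∧ B = A + u ∧ C = A + v :=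
    ⟨B - A, C - A, hind, by simp, by simp⟩
  clear hind
  obtain ⟨u, v, hind, rfl, rfl⟩ := hcoord
  have eA : A = A + ((0 : F) • u + (0 : F) • v) := by module
  have eB : A + u = A + ((1 : F) • u + (0 : F) • v) := by module
  have eC : A + v = A + ((0 : F) • u + (1 : F) • v) := by module
  have eA' : A' = A + ((1 - x) • u + x • v) := by rw [hA']; module
  have eB' : B' = A + ((0 : F) • u + (1 - y) • v) := by rw [hB']; module
  have eC' : C' = A + (z • u + (0 : F) • v) := by rw [hC']; module
  have dA : A' - A = (1 - x) • u + x • v := by rw [eA']; module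
  have dB : B' - (A + u) = (-1 : F) • u + (1 - y) • v := by rw [eB']; module
  have dC : C' - (A + v) = z • u + (-1 : F) • v := by rw [eC']; module
  have hAA' (a b : F) := hind.add_smul_add_smul_mem_affineSpan_pair_iff A a b 0 0 (1 - x) x
  have hBB' (a b : F) := hind.add_smul_add_smul_mem_affineSpan_pair_iff A a b 1 0 0 (1 - y)
  have hCC' (a b : F) := hind.add_smul_add_smul_mem_affineSpan_pair_iff A a b 0 1 z 0
  have hAB (a b : F) := hind.add_smul_add_smul_mem_affineSpan_pair_iff A a b 0 0 1 0
  have hBC (a b : F) := hind.add_smul_add_smul_mem_affineSpan_pair_iff A a b 1 0 0 1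
  have hCA (a b : F) := hind.add_smul_add_smul_mem_affineSpan_pair_iff A a b 0 1 0 0
  rw [← eA, ← eA'] at hAA'
  rw [← eB, ← eB'] at hBB'
  rw [← eC, ← eC'] at hCC'
  rw [← eA, ← eB] at hAB
  rw [← eB, ← eC] at hBC
  rw [← eC, ← eA] at hCA
  rw [dA, dB, dC]
  simp only [LinearIndependent.pair_add_smul_add_smul_iff, hind, true_and, not_not, ne_eq]
  constructor
  · rintro (⟨P, hPA, hPB, hPC, hAB', hBC', hCA'⟩ | ⟨h₁, h₂, h₃⟩)
    · obtain ⟨a, b, rfl⟩ : ∃ a b : F, P = A + (a • u + b • v) := by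
        rw [mem_affineSpan_pair_iff_exists_lineMap_eq] at hPA
        obtain ⟨t, rfl⟩ := hPA
        refine ⟨t * (1 - x), t * x, ?_⟩
        rw [AffineMap.lineMap_apply_module', eA']
        module
      obtain ⟨p, hp₁, hp₂⟩ := (hAA' a b).1 hPA
      obtain ⟨q, hq₁, hq₂⟩ := (hBB' a b).1 hPB
      obtain ⟨r, hr₁, hr₂⟩ := (hCC' a b).1 hPC
      have hb : b ≠ 0 := fun hb => hAB' ((hAB a b).2 ⟨a, by ring, by rw [hb]; ring⟩)
      have ha : a ≠ 0 := fun ha => hCA' ((hCA a b).2 ⟨1 - b, by rw [ha]; ring, by ring⟩)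
      have hc : 1 - a - b ≠ 0 := fun hc =>
        hBC' ((hBC a b).2 ⟨b, by linear_combination hc, by ring⟩)
      have ratioA : a * x = b * (1 - x) := by rw [← hp₁, ← hp₂]; ring
      have ratioB : b * y = (1 - a - b) * (1 - y) := by rw [← hq₁, ← hq₂]; ring
      have ratioC : (1 - a - b) * z = a * (1 - z) := by rw [← hr₁, ← hr₂]; ring
      refine mul_left_cancel₀ (mul_ne_zero (mul_ne_zero ha hb) hc) ?_
      calc a * b * (1 - a - b) * (x * y * z)
          = a * x * (b * y) * ((1 - a - b) * z) := by ring
        _ = b * (1 - x) * ((1 - a - b) * (1 - y)) * (a * (1 - z)) := by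
          rw [ratioA, ratioB, ratioC]
        _ = a * b * (1 - a - b) * ((1 - x) * (1 - y) * (1 - z)) := by ring
    · linear_combination (-y) * h₃ - (1 - x) * h₂
  · intro h
    by_cases hD : 1 - y + x * y = 0
    · have h₃ : x * z = -(1 - x) := mul_left_cancel₀ (mul_ne_zero hx0 hy0) (by
        linear_combination h + (1 - x) * (1 - z) * hD)
      right
      refine ⟨by linear_combination hD, ?_, by linear_combination -h₃⟩
      linear_combination y * h₃ - z * hD + hD
    · left
      have hx1' : 1 - x ≠ 0 := sub_ne_zero.2 hx1.symm
      have hy1' : 1 - y ≠ 0 := sub_ne_zero.2 hy1.symm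
      refine ⟨A + (((1 - y) * (1 - x) / (1 - y + x * y)) • u +
        ((1 - y) * x / (1 - y + x * y)) • v),
        (hAA' _ _).2 ⟨(1 - y) / (1 - y + x * y), by ring, by ring⟩,
        (hBB' _ _).2 ⟨x / (1 - y + x * y), by field_simp; ring, by ring⟩,
        (hCC' _ _).2 ⟨(1 - x) * (1 - y) / ((1 - y + x * y) * z), by field_simp; ring, ?_⟩,
        fun hm => ?_, fun hm => ?_, fun hm => ?_⟩
      · field_simp
        linear_combination h
      · obtain ⟨t, -, ht⟩ := (hAB _ _).1 hm
        exact div_ne_zero (mul_ne_zero hy1' hx0) hD (by rw [← ht]; ring)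
      · obtain ⟨t, ht₁, ht₂⟩ := (hBC _ _).1 hm
        have hc : x * y / (1 - y + x * y) = 0 := by
          calc x * y / (1 - y + x * y)
              = 1 - (1 - y) * (1 - x) / (1 - y + x * y) - (1 - y) * x / (1 - y + x * y) := by
                field_simp; ring
            _ = 0 := by rw [← ht₁, ← ht₂]; ring
        exact div_ne_zero (mul_ne_zero hx0 hy0) hD hc
      · obtain ⟨t, ht, -⟩ := (hCA _ _).1 hm
        exact div_ne_zero (mul_ne_zero hy1' hx1') hD (by rw [← ht]; ring)
end

section
/- Let V and W be nontrivial finite-dimensional vector spaces over a field F and let f, g : V → W be linear equivalences. Then f and g induce the same map on projective points — that is, for every nonzero v ∈ V the 1-dimensional subspace spanned by f(v) equals the 1-dimensional subspace spanned by g(v) — if and only if there exists a nonzero scalar a ∈ F with g = a • f. -/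
/-- Two isomorphisms between nontrivial finite-dimensional vector spaces induce the same
projective transformation (the spans of `f v` and `g v` agree for every nonzero `v`) if and
only if they are proportional by a nonzero scalar. -/
theorem projective_transformation_eq_iff_proportional {F V W : Type*} [Field F]
    [AddCommGroup V] [Module F V] [AddCommGroup W] [Module F W]
    [FiniteDimensional F V] [FiniteDimensional F W] [Nontrivial V] [Nontrivial W]
    (f g : V ≃ₗ[F] W) :
    (∀ v : V, v ≠ 0 → Submodule.span F {f v} = Submodule.span F {g v}) ↔
      ∃ a : F, a ≠ 0 ∧ ∀ v, g v = a • f v := by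
  constructor
  · intro h
    obtain ⟨a, ha⟩ := LinearMap.exists_eq_smul_id_of_forall_notLinearIndependent
      (f := (g.trans f.symm : V →ₗ[F] V)) fun v hv ↦ by
        have hv0 : v ≠ 0 := by simpa using hv.ne_zero 0
        have hmem : g v ∈ Submodule.span F {f v} :=
          h v hv0 ▸ Submodule.mem_span_singleton_self (g v)
        obtain ⟨c, hc⟩ := Submodule.mem_span_singleton.1 hmem
        refine (LinearIndependent.pair_iff' hv0).1 hv c ?_
        simp [← hc]
    have hg : ∀ v, g v = a • f v := fun v ↦ by
      simpa [LinearEquiv.symm_apply_eq] using LinearMap.congr_fun ha v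
    refine ⟨a, ?_, hg⟩
    rintro rfl
    obtain ⟨v, hv⟩ := exists_ne (0 : V)
    exact hv (g.map_eq_zero_iff.1 (by simp [hg v]))
  · rintro ⟨a, ha, hg⟩ v -
    rw [hg v, Submodule.span_singleton_smul_eq ha.isUnit]
end
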